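/- Let n ≥ 1, N = 2^n, and 0 ≤ i < N, and let T^{(n)}_{i,w} denote the number of vectors of Hamming weight w in the zero-coset C^{(n)}(0^i, 0) := span{g_{i+1}, …, g_{N-1}} ⊆ GF(2)^N. If i ≥ N/2, then T^{(n)}_{i,w} = 0 for odd w and T^{(n)}_{i,2w} = T^{(n-1)}_{i−N/2,w}; if i < N/2, then T^{(n)}_{i,w} = Σ_{w'} T^{(n-1)}_{i,w'} · C(N/2 − w', (w − w')/2) · 2^{w'}, the sum over all w' with 0 ≤ w' ≤ min(w, N/2) and w' ≡ w (mod 2), where T^{(n-1)} is defined analogously from the rows of G_{N/2} and C(·,·) is the binomial coefficient. -/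

import Mathlib

/-- Arıkan's 2×2 polarization kernel over GF(2). -/
def G2 : Matrix (Fin 2) (Fin 2) (ZMod 2) := !![1, 0; 1, 1]

/-- `G n` is the `n`-th Kronecker power `G₂^{⊗n}`, an `2^n × 2^n` matrix over GF(2).
The index `a * 2^n + b` corresponds to the pair `(a, b)`, so the most significant bit
comes from the leftmost Kronecker factor. -/
def G : (n : ℕ) → Matrix (Fin (2 ^ n)) (Fin (2 ^ n)) (ZMod 2)
  | 0 => 1
  | n + 1 =>
    Matrix.reindex (finProdFinEquiv.trans (finCongr (by ring)))
      (finProdFinEquiv.trans (finCongr (by ring)))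
      (Matrix.kroneckerMap (· * ·) G2 (G n))

/-- The `i`-th row `g_i` of `G n`. -/
def row (n : ℕ) (i : Fin (2 ^ n)) : Fin (2 ^ n) → ZMod 2 := G n i

/-- `bit i j` is the `j`-th bit in the binary representation of `i`. -/
def bit (i j : ℕ) : ℕ := i / 2 ^ j % 2

/-- The span of the rows `g_j` of `G n` with `j > i`. -/
def spanAbove (n : ℕ) (i : ℕ) : Submodule (ZMod 2) (Fin (2 ^ n) → ZMod 2) :=
  Submodule.span (ZMod 2) {v | ∃ j : Fin (2 ^ n), i < (j : ℕ) ∧ v = row n j}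

/-- The one-coset `C^{(n)}(0^i, 1) = g_i + ⟨g_{i+1}, …, g_{N-1}⟩`. -/
def oneCoset (n : ℕ) (i : Fin (2 ^ n)) : Set (Fin (2 ^ n) → ZMod 2) :=
  {x | ∃ v ∈ spanAbove n (i : ℕ), x = row n i + v}

/-- `S n i w` is the number of vectors of Hamming weight `w` in `C^{(n)}(0^i, 1)`. -/
noncomputable def S (n : ℕ) (i : Fin (2 ^ n)) (w : ℕ) : ℕ :=
  {x ∈ oneCoset n i | hammingNorm x = w}.ncard

/-- Concatenation of two vectors of length `2^n` into a vector of length `2^(n+1)`. -/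
def app2 {n : ℕ} (a b : Fin (2 ^ n) → ZMod 2) : Fin (2 ^ (n + 1)) → ZMod 2 :=
  fun k => Fin.append a b (finCongr (by ring : 2 ^ (n + 1) = 2 ^ n + 2 ^ n) k)

/-- The zero-coset `C^{(n)}(0^i, 0) = ⟨g_{i+1}, …, g_{N-1}⟩`. -/
def zeroCoset (n : ℕ) (i : Fin (2 ^ n)) : Set (Fin (2 ^ n) → ZMod 2) :=
  (spanAbove n (i : ℕ) : Set (Fin (2 ^ n) → ZMod 2))

/-- `T n i w` is the number of vectors of Hamming weight `w` in `C^{(n)}(0^i, 0)`. -/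
noncomputable def T (n : ℕ) (i : Fin (2 ^ n)) (w : ℕ) : ℕ :=
  {x ∈ zeroCoset n i | hammingNorm x = w}.ncard

/-- The pair `(a, b)` of a half and a position in it corresponds to the index `a * 2^n + b`. -/
def halfEquiv (n : ℕ) : Fin 2 × Fin (2 ^ n) ≃ Fin (2 ^ (n + 1)) :=
  finProdFinEquiv.trans (finCongr (by ring))

lemma halfEquiv_val (n : ℕ) (a : Fin 2) (b : Fin (2 ^ n)) :
    (halfEquiv n (a, b) : ℕ) = b + 2 ^ n * a := by
  simp [halfEquiv]

lemma row_halfEquiv (n : ℕ) (a c : Fin 2) (b d : Fin (2 ^ n)) :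
    row (n + 1) (halfEquiv n (a, b)) (halfEquiv n (c, d)) = G2 a c * row n b d := by
  simp [row, G, halfEquiv]

/-- The vector `(u + v, v)`, as a linear map of `(u, v)` (the Plotkin construction). -/
def plotkin (n : ℕ) : ((Fin (2 ^ n) → ZMod 2) × (Fin (2 ^ n) → ZMod 2)) →ₗ[ZMod 2]
    (Fin (2 ^ (n + 1)) → ZMod 2) where
  toFun p k := if ((halfEquiv n).symm k).1 = 0
    then p.1 ((halfEquiv n).symm k).2 + p.2 ((halfEquiv n).symm k).2
    else p.2 ((halfEquiv n).symm k).2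
  map_add' p q := by
    ext k
    simp only [Prod.fst_add, Prod.snd_add, Pi.add_apply]
    split_ifs <;> ring
  map_smul' c p := by
    ext k
    simp only [Prod.smul_fst, Prod.smul_snd, Pi.smul_apply, smul_eq_mul, RingHom.id_apply]
    split_ifs <;> ring

lemma plotkin_zero (n : ℕ) (p) (d : Fin (2 ^ n)) :
    plotkin n p (halfEquiv n (0, d)) = p.1 d + p.2 d := by
  simp [plotkin]

lemma plotkin_one (n : ℕ) (p) (d : Fin (2 ^ n)) :
    plotkin n p (halfEquiv n (1, d)) = p.2 d := by
  simp [plotkin]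

lemma eq_of_halves {n : ℕ} {x y : Fin (2 ^ (n + 1)) → ZMod 2}
    (h₀ : ∀ d, x (halfEquiv n (0, d)) = y (halfEquiv n (0, d)))
    (h₁ : ∀ d, x (halfEquiv n (1, d)) = y (halfEquiv n (1, d))) : x = y := by
  ext k
  obtain ⟨⟨c, d⟩, rfl⟩ := (halfEquiv n).surjective k
  fin_cases c
  · exact h₀ d
  · exact h₁ d

lemma plotkin_injective (n : ℕ) : Function.Injective (plotkin n) := by
  rintro ⟨u, v⟩ ⟨u', v'⟩ h
  have h₁ : v = v' := by
    ext d
    simpa only [plotkin_one] using congrFun h (halfEquiv n (1, d))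
  subst h₁
  have h₀ : u = u' := by
    ext d
    simpa only [plotkin_zero, add_left_inj] using congrFun h (halfEquiv n (0, d))
  rw [h₀]

lemma row_lower (n : ℕ) (b : Fin (2 ^ n)) :
    row (n + 1) (halfEquiv n (0, b)) = plotkin n (row n b, 0) := by
  apply eq_of_halves <;> intro d
  · simp [row_halfEquiv, plotkin_zero, G2]
  · simp [row_halfEquiv, plotkin_one, G2]

lemma row_upper (n : ℕ) (b : Fin (2 ^ n)) :
    row (n + 1) (halfEquiv n (1, b)) = plotkin n (0, row n b) := by
  apply eq_of_halves <;> intro d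
  · simp [row_halfEquiv, plotkin_zero, G2]
  · simp [row_halfEquiv, plotkin_one, G2]

lemma hammingNorm_plotkin (n : ℕ) (u v : Fin (2 ^ n) → ZMod 2) :
    hammingNorm (plotkin n (u, v)) = hammingNorm (u + v) + hammingNorm v := by
  simp only [hammingNorm, Finset.card_filter]
  rw [← (halfEquiv n).sum_comp, Fintype.sum_prod_type, Fin.sum_univ_two]
  simp only [plotkin_zero, plotkin_one, Pi.add_apply]

lemma span_range_row (n : ℕ) : Submodule.span (ZMod 2) (Set.range (row n)) = ⊤ := by
  induction n with
  | zero =>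
    rw [eq_top_iff]
    intro x _
    have hx : x = x 0 • row 0 0 := by
      ext k
      have hk : k = 0 := Subsingleton.elim (α := Fin 1) _ _
      subst hk
      simp [row, G]
    rw [hx]
    exact Submodule.smul_mem _ _ (Submodule.subset_span ⟨0, rfl⟩)
  | succ n ih =>
    have h₀ : Submodule.map (plotkin n ∘ₗ LinearMap.inl _ _ _) ⊤ ≤
        Submodule.span (ZMod 2) (Set.range (row (n + 1))) := by
      rw [← ih, Submodule.map_span, Submodule.span_le]
      rintro _ ⟨_, ⟨b, rfl⟩, rfl⟩
      exact Submodule.subset_span ⟨_, row_lower n b⟩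
    have h₁ : Submodule.map (plotkin n ∘ₗ LinearMap.inr _ _ _) ⊤ ≤
        Submodule.span (ZMod 2) (Set.range (row (n + 1))) := by
      rw [← ih, Submodule.map_span, Submodule.span_le]
      rintro _ ⟨_, ⟨b, rfl⟩, rfl⟩
      exact Submodule.subset_span ⟨_, row_upper n b⟩
    rw [eq_top_iff]
    intro x _
    have hx : x = (plotkin n ∘ₗ LinearMap.inl _ _ _)
          (fun d => x (halfEquiv n (0, d)) - x (halfEquiv n (1, d))) +
        (plotkin n ∘ₗ LinearMap.inr _ _ _) (fun d => x (halfEquiv n (1, d))) := by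
      apply eq_of_halves <;> intro d
      · simp [plotkin_zero]
      · simp [plotkin_one]
    rw [hx]
    exact add_mem (h₀ ⟨_, trivial, rfl⟩) (h₁ ⟨_, trivial, rfl⟩)

lemma spanAbove_upper {n i : ℕ} (h : 2 ^ n ≤ i) :
    spanAbove (n + 1) i =
      (spanAbove n (i - 2 ^ n)).map (plotkin n ∘ₗ LinearMap.inr _ _ _) := by
  rw [spanAbove, spanAbove, Submodule.map_span]
  congr 1
  ext x
  constructor
  · rintro ⟨j, hj, rfl⟩
    obtain ⟨⟨a, b⟩, rfl⟩ := (halfEquiv n).surjective j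
    have hb := b.isLt
    rw [halfEquiv_val] at hj
    fin_cases a
    · simp at hj
      omega
    · simp at hj
      exact ⟨_, ⟨b, by omega, rfl⟩, (row_upper n b).symm⟩
  · rintro ⟨_, ⟨b, hb, rfl⟩, rfl⟩
    refine ⟨halfEquiv n (1, b), ?_, (row_upper n b).symm⟩
    rw [halfEquiv_val]
    simp
    omega

lemma spanAbove_lower {n i : ℕ} (h : i < 2 ^ n) :
    spanAbove (n + 1) i = ((spanAbove n i).prod ⊤).map (plotkin n) := by
  apply le_antisymm
  · rw [spanAbove, Submodule.span_le]
    rintro _ ⟨j, hj, rfl⟩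
    obtain ⟨⟨a, b⟩, rfl⟩ := (halfEquiv n).surjective j
    rw [halfEquiv_val] at hj
    fin_cases a
    · refine ⟨(row n b, 0), ⟨Submodule.subset_span ⟨b, by simpa using hj, rfl⟩, trivial⟩,
        (row_lower n b).symm⟩
    · exact ⟨(0, row n b), ⟨zero_mem _, trivial⟩, (row_upper n b).symm⟩
  · have h₀ : (spanAbove n i).map (plotkin n ∘ₗ LinearMap.inl _ _ _) ≤ spanAbove (n + 1) i := by
      rw [spanAbove, Submodule.map_span, Submodule.span_le]
      rintro _ ⟨_, ⟨b, hb, rfl⟩, rfl⟩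
      refine Submodule.subset_span ⟨halfEquiv n (0, b), ?_, (row_lower n b).symm⟩
      simpa [halfEquiv_val] using hb
    have h₁ : Submodule.map (plotkin n ∘ₗ LinearMap.inr _ _ _) ⊤ ≤ spanAbove (n + 1) i := by
      rw [← span_range_row, Submodule.map_span, Submodule.span_le]
      rintro _ ⟨_, ⟨b, rfl⟩, rfl⟩
      refine Submodule.subset_span ⟨halfEquiv n (1, b), ?_, (row_upper n b).symm⟩
      simp [halfEquiv_val]
      omega
    rintro _ ⟨⟨u, v⟩, ⟨hu, -⟩, rfl⟩
    have huv : plotkin n (u, v) = plotkin n (u, 0) + plotkin n (0, v) := by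
      rw [← map_add]
      simp
    rw [huv]
    exact add_mem (h₀ ⟨u, hu, rfl⟩) (h₁ ⟨v, trivial, rfl⟩)

section Counting

variable {ι : Type*} [Fintype ι]

lemma hammingNorm_add_add_hammingNorm (u v : ι → ZMod 2) :
    hammingNorm (u + v) + hammingNorm v =
      hammingNorm u + 2 * (Finset.univ.filter fun k => v k ≠ 0 ∧ u k = 0).card := by
  simp only [hammingNorm, Finset.card_filter, Finset.mul_sum]
  rw [← Finset.sum_add_distrib, ← Finset.sum_add_distrib]
  refine Finset.sum_congr rfl fun k _ => ?_
  have hb : ∀ b : ZMod 2, b = 0 ∨ b = 1 := by decide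
  have h2 : (1 + 1 : ZMod 2) = 0 := by decide
  rcases hb (u k) with hu | hu <;> rcases hb (v k) with hv | hv <;> simp [hu, hv, h2]

lemma card_filter_outside_support [DecidableEq ι] (u : ι → ZMod 2) (m : ℕ) :
    (Finset.univ.filter fun v : ι → ZMod 2 =>
      (Finset.univ.filter fun k => v k ≠ 0 ∧ u k = 0).card = m).card =
      (Fintype.card ι - hammingNorm u).choose m * 2 ^ hammingNorm u := by
  have hcompl : (Finset.univ.filter fun k => u k = 0).card = Fintype.card ι - hammingNorm u := by
    have := Finset.card_filter_add_card_filter_not (s := (Finset.univ : Finset ι)) (fun k => u k = 0)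
    rw [Finset.card_univ] at this
    simp only [hammingNorm, ne_eq]
    omega
  rw [← hcompl, ← Finset.card_powersetCard, hammingNorm, ← Finset.card_powerset,
    ← Finset.card_product]
  refine Finset.card_bij'
    (fun v _ => (Finset.univ.filter fun k => v k ≠ 0 ∧ u k = 0,
      Finset.univ.filter fun k => v k ≠ 0 ∧ u k ≠ 0))
    (fun p _ k => if k ∈ p.1 ∪ p.2 then 1 else 0) ?_ ?_ ?_ ?_
  · intro v hv
    simp only [Finset.mem_filter, Finset.mem_univ, true_and] at hv
    simp only [Finset.mem_product, Finset.mem_powersetCard, Finset.mem_powerset]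
    refine ⟨⟨fun k => ?_, hv⟩, fun k => ?_⟩ <;> simp +contextual
  · rintro ⟨A, B⟩ hp
    simp only [Finset.mem_product, Finset.mem_powersetCard, Finset.mem_powerset] at hp
    obtain ⟨⟨hA, rfl⟩, hB⟩ := hp
    simp only [Finset.mem_filter, Finset.mem_univ, true_and]
    congr 1
    ext k
    have h₁ := @hA k
    have h₂ := @hB k
    simp at h₁ h₂ ⊢
    tauto
  · intro v _
    ext k
    have hb : ∀ b : ZMod 2, b ≠ 0 → b = 1 := by decide
    by_cases h : v k = 0
    · simp [h]
    · by_cases h' : u k = 0 <;> simp [h', hb _ h]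
  · rintro ⟨A, B⟩ hp
    simp only [Finset.mem_product, Finset.mem_powersetCard, Finset.mem_powerset] at hp
    obtain ⟨⟨hA, -⟩, hB⟩ := hp
    ext k <;>
    · have h₁ := @hA k
      have h₂ := @hB k
      simp at h₁ h₂ ⊢
      tauto

lemma card_filter_hammingNorm_add [DecidableEq ι] {u : ι → ZMod 2} {w : ℕ} (hle : hammingNorm u ≤ w)
    (hmod : hammingNorm u % 2 = w % 2) :
    (Finset.univ.filter fun v : ι → ZMod 2 => hammingNorm (u + v) + hammingNorm v = w).card =
      (Fintype.card ι - hammingNorm u).choose ((w - hammingNorm u) / 2) * 2 ^ hammingNorm u := by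
  rw [← card_filter_outside_support]
  congr 1
  refine Finset.filter_congr fun v _ => ?_
  rw [hammingNorm_add_add_hammingNorm]
  omega

end Counting

lemma T_upper {n i : ℕ} (hi : i < 2 ^ (n + 1)) (h : 2 ^ n ≤ i) (h' : i - 2 ^ n < 2 ^ n) (w : ℕ) :
    T (n + 1) ⟨i, hi⟩ (2 * w) = T n ⟨i - 2 ^ n, h'⟩ w := by
  have hinj : Function.Injective (plotkin n ∘ₗ LinearMap.inr (ZMod 2) _ _) := by
    rw [LinearMap.coe_comp]
    exact (plotkin_injective n).comp LinearMap.inr_injective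
  rw [T, T, ← Set.ncard_image_of_injective _ hinj]
  congr 1
  ext x
  simp only [zeroCoset, spanAbove_upper h, SetLike.mem_coe, Set.mem_ofPred_eq, Set.mem_image,
    Submodule.mem_map]
  constructor
  · rintro ⟨⟨v, hv, rfl⟩, hw⟩
    refine ⟨v, ⟨hv, ?_⟩, rfl⟩
    simp [hammingNorm_plotkin] at hw
    omega
  · rintro ⟨v, ⟨hv, hw⟩, rfl⟩
    refine ⟨⟨v, hv, rfl⟩, ?_⟩
    simp [hammingNorm_plotkin]
    omega

lemma T_upper_odd {n i : ℕ} (hi : i < 2 ^ (n + 1)) (h : 2 ^ n ≤ i) {w : ℕ} (hw : Odd w) :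
    T (n + 1) ⟨i, hi⟩ w = 0 := by
  rw [T, Set.ncard_eq_zero, Set.eq_empty_iff_forall_notMem]
  rintro x ⟨hx, rfl⟩
  simp only [zeroCoset, spanAbove_upper h, SetLike.mem_coe, Submodule.mem_map] at hx
  obtain ⟨v, -, rfl⟩ := hx
  simp only [LinearMap.comp_apply, LinearMap.inr_apply, hammingNorm_plotkin, zero_add] at hw
  exact Nat.not_odd_iff_even.mpr (Even.add_self _) hw

open Classical in
lemma T_eq_card (n : ℕ) (i : Fin (2 ^ n)) (w : ℕ) :
    T n i w = (Finset.univ.filter fun x => x ∈ spanAbove n i ∧ hammingNorm x = w).card := by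
  rw [T, ← Set.ncard_coe_finset]
  congr 1
  ext x
  simp [zeroCoset]

open Classical in
lemma T_lower_eq_sum {n i : ℕ} (hi : i < 2 ^ (n + 1)) (h : i < 2 ^ n) (w : ℕ) :
    T (n + 1) ⟨i, hi⟩ w = ∑ u ∈ Finset.univ.filter (· ∈ spanAbove n i),
      (Finset.univ.filter fun v => hammingNorm (u + v) + hammingNorm v = w).card := by
  rw [T_eq_card, ← Finset.card_sigma]
  symm
  refine Finset.card_bij (fun p _ => plotkin n (p.1, p.2)) ?_ ?_ ?_
  · rintro ⟨u, v⟩ hp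
    simp only [Finset.mem_sigma, Finset.mem_filter, Finset.mem_univ, true_and] at hp ⊢
    rw [spanAbove_lower h, hammingNorm_plotkin]
    exact ⟨⟨(u, v), ⟨hp.1, trivial⟩, rfl⟩, hp.2⟩
  · rintro ⟨u, v⟩ _ ⟨u', v'⟩ _ heq
    obtain ⟨rfl, rfl⟩ := Prod.mk.inj (plotkin_injective n heq)
    rfl
  · intro x hx
    simp only [Finset.mem_filter, Finset.mem_univ, true_and] at hx
    rw [spanAbove_lower h] at hx
    obtain ⟨⟨⟨u, v⟩, ⟨hu, -⟩, rfl⟩, hw⟩ := hx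
    rw [hammingNorm_plotkin] at hw
    exact ⟨⟨u, v⟩, by simpa using ⟨hu, hw⟩, rfl⟩

lemma T_lower {n i : ℕ} (hi : i < 2 ^ (n + 1)) (h : i < 2 ^ n) (w : ℕ) :
    T (n + 1) ⟨i, hi⟩ w =
      ∑ w' ∈ (Finset.range (min w (2 ^ n) + 1)).filter (fun w' => w' % 2 = w % 2),
        T n ⟨i, h⟩ w' * (2 ^ n - w').choose ((w - w') / 2) * 2 ^ w' := by
  classical
  rw [T_lower_eq_sum hi h]
  set R := (Finset.range (min w (2 ^ n) + 1)).filter (fun w' => w' % 2 = w % 2) with hR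
  have hmem : ∀ u : Fin (2 ^ n) → ZMod 2,
      hammingNorm u ∈ R ↔ hammingNorm u ≤ w ∧ hammingNorm u % 2 = w % 2 := by
    intro u
    have hle : hammingNorm u ≤ 2 ^ n := by simpa using hammingNorm_le_card_fintype (x := u)
    simp only [hR, Finset.mem_filter, Finset.mem_range]
    omega
  rw [← Finset.sum_filter_of_ne (p := fun u => hammingNorm u ∈ R),
    ← Finset.sum_fiberwise_of_maps_to (t := R) (g := hammingNorm)]
  · refine Finset.sum_congr rfl fun w' hw' => ?_
    have hset : ((Finset.univ.filter (· ∈ spanAbove n i)).filter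
          (fun u => hammingNorm u ∈ R)).filter (fun u => hammingNorm u = w') =
        Finset.univ.filter fun x => x ∈ spanAbove n i ∧ hammingNorm x = w' := by
      ext u
      simp only [Finset.mem_filter, Finset.mem_univ, true_and]
      constructor
      · rintro ⟨⟨hu, -⟩, hw⟩
        exact ⟨hu, hw⟩
      · rintro ⟨hu, rfl⟩
        exact ⟨⟨hu, hw'⟩, rfl⟩
    rw [hset, T_eq_card, mul_assoc, ← smul_eq_mul, ← Finset.sum_const]
    refine Finset.sum_congr rfl fun u hu => ?_
    obtain rfl := (Finset.mem_filter.mp hu).2.2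
    obtain ⟨hle, hmod⟩ := (hmem u).mp hw'
    rw [card_filter_hammingNorm_add hle hmod, Fintype.card_fin]
  · intro u hu
    exact (Finset.mem_filter.mp hu).2
  · intro u _ hne
    obtain ⟨v, hv⟩ := Finset.card_ne_zero.mp hne
    have hv' := (Finset.mem_filter.mp hv).2
    rw [hammingNorm_add_add_hammingNorm] at hv'
    rw [hmem]
    omega

/-- Let `n ≥ 1` and `N = 2^n` (written with `n+1` so that `N/2 = 2^n`), and
`0 ≤ i < N`. If `i ≥ N/2`, then `T^{(n)}_{i,w} = 0` for odd `w` and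
`T^{(n)}_{i,2w} = T^{(n-1)}_{i-N/2,w}`; if `i < N/2`, then
`T^{(n)}_{i,w} = Σ_{w'} T^{(n-1)}_{i,w'} · C(N/2 - w', (w-w')/2) · 2^{w'}`, summed over
`0 ≤ w' ≤ min(w, N/2)` with `w' ≡ w (mod 2)`. -/
theorem stmt_19 (n i : ℕ) (hi : i < 2 ^ (n + 1)) :
    (2 ^ n ≤ i →
      (∀ w, Odd w → T (n + 1) ⟨i, hi⟩ w = 0) ∧
      (∀ w, T (n + 1) ⟨i, hi⟩ (2 * w) = T n ⟨i - 2 ^ n, by rw [pow_succ] at hi; omega⟩ w)) ∧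
    (∀ h : i < 2 ^ n, ∀ w,
      T (n + 1) ⟨i, hi⟩ w =
        ∑ w' ∈ (Finset.range (min w (2 ^ n) + 1)).filter (fun w' => w' % 2 = w % 2),
          T n ⟨i, h⟩ w' * (2 ^ n - w').choose ((w - w') / 2) * 2 ^ w') := by
  exact ⟨fun h => ⟨fun _ hw => T_upper_odd hi h hw, fun w => T_upper hi h _ w⟩,
    fun h w => T_lower hi h w⟩
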